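/- Let p, r : ℕ, Ã ∈ ℝ^{p×p}, B̃ ∈ ℝ^{p×r}, let Q̃ ∈ ℝ^{p×p} be symmetric positive semidefinite and R̂ ∈ ℝ^{r×r} symmetric positive definite. Let P̂ ∈ ℝ^{p×p} be symmetric, let P̄ ∈ ℝ^{p×p} be symmetric positive definite, and let η ∈ ℝ. Assume: (i) the symmetric block matrix [[Ãᵀ P̂ + P̂ Ã + Q̃, P̂ B̃], [B̃ᵀ P̂, R̂]] is positive definite; (ii) the symmetric block matrix [[−(Ãᵀ P̄ + P̄ Ã + Q̃) + η·I, (P̂ − P̄) B̃], [B̃ᵀ (P̂ − P̄), R̂]] is positive definite; (iii) A_cl := Ã − B̃ R̂⁻¹ B̃ᵀ P̂ is Hurwitz. Let Y ∈ ℝ^{p×p} be symmetric with A_clᵀ Y + Y A_cl + Q̃ + P̂ B̃ R̂⁻¹ B̃ᵀ P̂ = 0, and let P̃_e ∈ ℝ^{p×p} be symmetric with A_clᵀ P̃_e + P̃_e A_cl + I = 0. Then P̄ + η·P̃_e − Y is positive definite; in particular, e₀ᵀ Y e₀ < e₀ᵀ (P̄ + η·P̃_e) e₀ for every e₀ ≠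 0. -/

import Mathlib

open Matrix Filter Topology
open scoped ENNReal NNReal

/-- In a complex Banach algebra, the powers of an element of spectral radius less than one
tend to zero. -/
theorem tendsto_pow_zero_of_spectralRadius_lt_one {A : Type*} [NormedRing A] [NormedAlgebra ℂ A]
    [CompleteSpace A] {a : A} (h : spectralRadius ℂ a < 1) :
    Tendsto (fun k : ℕ => a ^ k) atTop (𝓝 0) := by
  obtain ⟨c, hc, hc1⟩ := ENNReal.lt_iff_exists_nnreal_btwn.mp h
  have hc1' : c < 1 := by exact_mod_cast hc1
  have hev := (spectrum.pow_nnnorm_pow_one_div_tendsto_nhds_spectralRadius a).eventually_lt_const hc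
  refine squeeze_zero_norm' (a := fun k : ℕ => (c : ℝ) ^ k) ?_
    (tendsto_pow_atTop_nhds_zero_of_lt_one c.2 hc1')
  filter_upwards [hev, eventually_gt_atTop 0] with k hk hk0
  have h1 : (‖a ^ k‖₊ : ℝ≥0∞) ≤ (c : ℝ≥0∞) ^ k := by
    rw [← ENNReal.rpow_natCast, ← ENNReal.rpow_inv_le_iff (by positivity)]
    simpa using hk.le
  exact_mod_cast h1

/-- If the spectrum of `a` lies in the open left half-plane, the powers of its Cayley transform
`(1 + a) * (1 - a)⁻¹` tend to zero. -/
theorem tendsto_cayley_pow_zero {A : Type*} [NormedRing A] [NormedAlgebra ℂ A] [CompleteSpace A]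
    [Nontrivial A] {a m : A} (ha : ∀ μ ∈ spectrum ℂ a, μ.re < 0) (hm : m * (1 - a) = 1 + a) :
    Tendsto (fun k : ℕ => m ^ k) atTop (𝓝 0) := by
  have hN : IsUnit (1 - a) := by
    by_contra h
    have h1 : (1 : ℂ) ∈ spectrum ℂ a := by rwa [spectrum.mem_iff, map_one]
    have := ha 1 h1
    norm_num at this
  apply tendsto_pow_zero_of_spectralRadius_lt_one
  suffices spectralRadius ℂ m < ((1 : ℝ≥0) : ℝ≥0∞) by simpa using this
  refine spectrum.spectralRadius_lt_of_forall_lt m fun z hz => ?_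
  rw [spectrum.mem_iff, ← hN.unit.isUnit_mul_units, IsUnit.unit_spec] at hz
  have key : (algebraMap ℂ A z - m) * (1 - a) = algebraMap ℂ A (z - 1) - (z + 1) • a := by
    rw [sub_mul, hm, Algebra.smul_def, map_sub, map_add, map_one]
    noncomm_ring
  rw [key] at hz
  by_cases h1 : z + 1 = 0
  · exfalso
    apply hz
    rw [h1, zero_smul, sub_zero]
    refine (IsUnit.mk0 (z - 1) fun h2 => ?_).map (algebraMap ℂ A)
    have : (2 : ℂ) = 0 := by linear_combination h1 - h2
    norm_num at this
  · have hμ : (z - 1) / (z + 1) ∈ spectrum ℂ a := by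
      rw [spectrum.mem_iff]
      refine fun h => hz ?_
      have e : algebraMap ℂ A (z - 1) - (z + 1) • a
          = (z + 1) • (algebraMap ℂ A ((z - 1) / (z + 1)) - a) := by
        rw [smul_sub, Algebra.smul_def (z + 1) (algebraMap ℂ A _), ← map_mul, mul_div_cancel₀ _ h1]
      rw [e]
      exact h.smul (Units.mk0 _ h1)
    have hre := ha _ hμ
    have hpos : 0 < Complex.normSq (z + 1) := Complex.normSq_pos.2 h1
    rw [Complex.div_re, ← add_div, div_neg_iff] at hre
    have hlt : Complex.normSq z < 1 := by
      rcases hre with h | h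
      · linarith [h.2]
      · have := h.1
        simp [Complex.normSq_apply] at this ⊢
        nlinarith
    rw [Complex.normSq_eq_norm_sq] at hlt
    have : ‖z‖ < 1 := by nlinarith [norm_nonneg z]
    exact_mod_cast this

open scoped Matrix.Norms.Operator in
/-- Lyapunov's theorem: a symmetric solution of `Aᵀ * X + X * A = -W` with `A` Hurwitz and `W`
positive definite is positive definite. -/
theorem posDef_of_lyapunov {n : Type*} [Fintype n] [DecidableEq n] {A X W : Matrix n n ℝ}
    (hA : ∀ μ ∈ spectrum ℂ (A.map ((↑) : ℝ → ℂ)), μ.re < 0) (hX : X.IsHermitian)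
    (hW : W.PosDef) (h : Aᵀ * X + X * A = -W) : X.PosDef := by
  refine .of_dotProduct_mulVec_pos hX fun x hx => ?_
  rw [star_trivial]
  have : Nonempty n := by
    by_contra hn
    rw [not_nonempty_iff] at hn
    exact hx (Subsingleton.elim _ _)
  set φ : Matrix n n ℝ →+* Matrix n n ℂ := Complex.ofRealHom.mapMatrix with hφ
  have hN : IsUnit (1 - A) := by
    have h1 : IsUnit (φ (1 - A)) := by
      by_contra hu
      have h1 : (1 : ℂ) ∈ spectrum ℂ (φ A) := by
        rwa [spectrum.mem_iff, map_one, ← map_one φ, ← map_sub]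
      have := hA 1 h1
      norm_num at this
    rw [Matrix.isUnit_iff_isUnit_det, hφ, ← RingHom.map_det, isUnit_iff_ne_zero] at h1
    rw [Matrix.isUnit_iff_isUnit_det, isUnit_iff_ne_zero]
    exact fun h0 => h1 (by rw [h0, map_zero])
  obtain ⟨N, hN⟩ := hN
  obtain ⟨M, hM⟩ : ∃ M : Matrix n n ℝ, M * (1 - A) = 1 + A :=
    ⟨(1 + A) * (↑N⁻¹ : Matrix n n ℝ), by rw [← hN, mul_assoc, Units.inv_mul, mul_one]⟩
  have hlim : Tendsto (fun k : ℕ => M ^ k) atTop (𝓝 0) := by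
    have hc : Tendsto (fun k : ℕ => φ M ^ k) atTop (𝓝 0) :=
      tendsto_cayley_pow_zero (a := φ A) hA (by rw [← map_one φ, ← map_sub, ← map_mul, hM, map_add])
    have hre : Continuous fun Z : Matrix n n ℂ => Z.map Complex.re :=
      continuous_id.matrix_map Complex.continuous_re
    have h0 : (0 : Matrix n n ℂ).map Complex.re = 0 := by ext; simp
    have := (hre.tendsto 0).comp hc
    rw [h0] at this
    refine this.congr fun k => ?_
    rw [Function.comp_apply, ← map_pow]
    ext i j
    simp [hφ]
  have hstein : (1 - A)ᵀ * (X - Mᵀ * X * M) * (1 - A) = W + W := by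
    calc (1 - A)ᵀ * (X - Mᵀ * X * M) * (1 - A)
        = (1 - A)ᵀ * X * (1 - A) - (M * (1 - A))ᵀ * X * (M * (1 - A)) := by
          rw [transpose_mul]; simp only [mul_sub, sub_mul, mul_assoc]; abel
      _ = -((Aᵀ * X + X * A) + (Aᵀ * X + X * A)) := by
          rw [hM, transpose_sub, transpose_add, transpose_one]; noncomm_ring
      _ = W + W := by rw [h]; abel
  have hD : (X - Mᵀ * X * M).PosDef := by
    have := (hW.add hW).conjTranspose_mul_mul_same (B := (↑N⁻¹ : Matrix n n ℝ))
      (Matrix.mulVec_injective_of_isUnit (Units.isUnit _))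
    rw [← hstein, ← hN, conjTranspose_eq_transpose_of_trivial] at this
    convert this using 1
    calc X - Mᵀ * X * M
        = (↑N * ↑N⁻¹ : Matrix n n ℝ)ᵀ * (X - Mᵀ * X * M) * (↑N * ↑N⁻¹ : Matrix n n ℝ) := by simp
      _ = _ := by rw [transpose_mul]; simp only [mul_assoc]
  set q : ℕ → ℝ := fun k => (M ^ k *ᵥ x) ⬝ᵥ (X *ᵥ (M ^ k *ᵥ x)) with hq
  have hstep : ∀ k, q k - q (k + 1)
      = (M ^ k *ᵥ x) ⬝ᵥ ((X - Mᵀ * X * M) *ᵥ (M ^ k *ᵥ x)) := by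
    intro k
    have e : M ^ (k + 1) *ᵥ x = M *ᵥ (M ^ k *ᵥ x) := by rw [mulVec_mulVec, pow_succ']
    simp only [hq]
    rw [e, sub_mulVec, dotProduct_sub, Matrix.mul_assoc, ← mulVec_mulVec, ← mulVec_mulVec,
      dotProduct_mulVec _ Mᵀ, vecMul_transpose]
  have hanti : Antitone q := antitone_nat_of_succ_le fun k => by
    have := hD.posSemidef.dotProduct_mulVec_nonneg (M ^ k *ᵥ x)
    rw [star_trivial, ← hstep] at this
    linarith
  have hq0 : Tendsto q atTop (𝓝 0) := by
    have hc : Continuous fun Z : Matrix n n ℝ => (Z *ᵥ x) ⬝ᵥ (X *ᵥ (Z *ᵥ x)) := by fun_prop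
    have := (hc.tendsto 0).comp hlim
    rwa [zero_mulVec, zero_dotProduct] at this
  have h1 := hanti.le_of_tendsto hq0 1
  have h2 := hD.dotProduct_mulVec_pos hx
  have h3 := hstep 0
  simp only [hq, pow_zero, one_mulVec] at h1 h3
  rw [star_trivial] at h2
  simp only [zero_add] at h3
  linarith


/-- The paper's Proposition 7: suboptimality bound for the suboptimal consensus
protocol design for the neighboring-error dynamics. -/
theorem suboptimal_consensus_bound
    (p r : ℕ)
    (Atil : Matrix (Fin p) (Fin p) ℝ) (Btil : Matrix (Fin p) (Fin r) ℝ)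
    (Qtil : Matrix (Fin p) (Fin p) ℝ) (Rhat : Matrix (Fin r) (Fin r) ℝ)
    (hQ : Qtil.PosSemidef) (hR : Rhat.PosDef)
    (Phat : Matrix (Fin p) (Fin p) ℝ) (hPhatsymm : Phatᵀ = Phat)
    (Pbar : Matrix (Fin p) (Fin p) ℝ) (hPbar : Pbar.PosDef)
    (η : ℝ)
    (hLMI1 : (Matrix.fromBlocks (Atilᵀ * Phat + Phat * Atil + Qtil) (Phat * Btil)
      (Btilᵀ * Phat) Rhat).PosDef)
    (hLMI2 : (Matrix.fromBlocks
      (-(Atilᵀ * Pbar + Pbar * Atil + Qtil) + η • (1 : Matrix (Fin p) (Fin p) ℝ))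
      ((Phat - Pbar) * Btil)
      (Btilᵀ * (Phat - Pbar)) Rhat).PosDef)
    (Acl : Matrix (Fin p) (Fin p) ℝ) (hAcl : Acl = Atil - Btil * Rhat⁻¹ * Btilᵀ * Phat)
    (hHurwitz : ∀ μ ∈ spectrum ℂ (Acl.map ((↑) : ℝ → ℂ)), μ.re < 0)
    (Y : Matrix (Fin p) (Fin p) ℝ) (hYsymm : Yᵀ = Y)
    (hYlyap : Aclᵀ * Y + Y * Acl + Qtil + Phat * Btil * Rhat⁻¹ * Btilᵀ * Phat = 0)
    (Ptile : Matrix (Fin p) (Fin p) ℝ) (hPtilesymm : Ptileᵀ = Ptile)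
    (hPtile : Aclᵀ * Ptile + Ptile * Acl + 1 = 0) :
    (Pbar + η • Ptile - Y).PosDef ∧
    ∀ e₀ : Fin p → ℝ, e₀ ≠ 0 →
      e₀ ⬝ᵥ (Y *ᵥ e₀) < e₀ ⬝ᵥ ((Pbar + η • Ptile) *ᵥ e₀) := by
  have hRu : IsUnit Rhat.det := (Matrix.isUnit_iff_isUnit_det _).1 hR.isUnit
  have hRs : Rhatᵀ = Rhat := by
    simpa [conjTranspose_eq_transpose_of_trivial] using hR.isHermitian.eq
  have hPs : Pbarᵀ = Pbar := by
    simpa [conjTranspose_eq_transpose_of_trivial] using hPbar.isHermitian.eq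
  have hpos : (Pbar + η • Ptile - Y).PosDef := by
    refine posDef_of_lyapunov hHurwitz ?_ (hLMI2.conjTranspose_mul_mul_same
      (B := fromRows (1 : Matrix (Fin p) (Fin p) ℝ) (-(Rhat⁻¹ * Btilᵀ * Phat))) ?_) ?_
    · rw [IsHermitian, conjTranspose_eq_transpose_of_trivial, transpose_sub, transpose_add,
        transpose_smul, hPs, hPtilesymm, hYsymm]
    · intro x y hxy
      simpa using congrArg (fun v => v ∘ Sum.inl) hxy
    · have hK : (-(Rhat⁻¹ * Btilᵀ * Phat))ᵀ = -(Phat * Btil * Rhat⁻¹) := by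
        simp [transpose_mul, transpose_nonsing_inv, hRs, hPhatsymm, Matrix.mul_assoc]
      have hRR : Phat * Btil * Rhat⁻¹ * (Rhat * (Rhat⁻¹ * Btilᵀ * Phat))
          = Phat * Btil * Rhat⁻¹ * Btilᵀ * Phat := by
        rw [Matrix.mul_assoc Rhat⁻¹, Matrix.mul_nonsing_inv_cancel_left _ _ hRu]
        simp only [Matrix.mul_assoc]
      have hAclT : Aclᵀ = Atilᵀ - Phat * Btil * Rhat⁻¹ * Btilᵀ := by
        rw [hAcl]
        simp [transpose_mul, transpose_nonsing_inv, hRs, hPhatsymm, Matrix.mul_assoc]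
      have hYl : Aclᵀ * Y + Y * Acl = -(Qtil + Phat * Btil * Rhat⁻¹ * Btilᵀ * Phat) := by
        rw [eq_neg_iff_add_eq_zero, ← add_assoc]; exact hYlyap
      have hPl : Aclᵀ * Ptile + Ptile * Acl = -1 := eq_neg_iff_add_eq_zero.2 hPtile
      calc Aclᵀ * (Pbar + η • Ptile - Y) + (Pbar + η • Ptile - Y) * Acl
          = (Aclᵀ * Pbar + Pbar * Acl) + η • (Aclᵀ * Ptile + Ptile * Acl)
              - (Aclᵀ * Y + Y * Acl) := by
            simp only [Matrix.mul_add, Matrix.add_mul, Matrix.mul_sub, Matrix.sub_mul,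
              Matrix.mul_smul, Matrix.smul_mul, smul_add]
            abel
        _ = _ := by
            rw [hYl, hPl, hAclT, hAcl, conjTranspose_eq_transpose_of_trivial, transpose_fromRows,
              hK, transpose_one, Matrix.mul_assoc (fromCols _ _), fromBlocks_mul_fromRows,
              fromCols_mul_fromRows]
            simp only [Matrix.mul_add, Matrix.mul_sub, Matrix.sub_mul,
              Matrix.mul_neg, Matrix.neg_mul, Matrix.mul_one, Matrix.one_mul, hRR, smul_neg]
            simp only [Matrix.mul_assoc]
            abel
  refine ⟨hpos, fun e₀ he => ?_⟩
  have := hpos.dotProduct_mulVec_pos he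
  rw [star_trivial, sub_mulVec, dotProduct_sub] at this
  linarith
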